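/- Let p and q be prime numbers with p ≡ 5 (mod 8) and q ≡ 3 (mod 8) (the Legendre symbol (p/q) may be 1 or −1). Then the 2-class group of the imaginary biquadratic field ℚ(√(2pq), i) is isomorphic to ℤ/2ℤ × ℤ/2ℤ. -/

import Mathlib

/-- The 2-class group of a subfield `K` of `ℂ` (i.e. the 2-Sylow subgroup of
the class group of its ring of integers) is of type `(2,2)`,
i.e. isomorphic to `ℤ/2ℤ × ℤ/2ℤ`. -/
def TwoClassGroupIsTypeTwoTwo (K : IntermediateField ℚ ℂ) : Prop :=
  ∀ P : Sylow 2 (ClassGroup (integralClosure ℤ K)),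
    Nonempty (P ≃* Multiplicative (ZMod 2 × ZMod 2))

theorem Sylow.nonempty_mulEquiv_zmod_two_prod {G : Type*} [CommGroup G] [Finite G]
    {a b : G} (ha : a ^ 2 = 1) (hb : b ^ 2 = 1)
    (ha' : ∀ x : G, x ^ 2 ≠ a) (hb' : ∀ x : G, x ^ 2 ≠ b) (hab : ∀ x : G, x ^ 2 ≠ a * b)
    (h : ∀ x : G, x ^ 2 = 1 → x = 1 ∨ x = a ∨ x = b ∨ x = a * b) (P : Sylow 2 G) :
    Nonempty (P ≃* Multiplicative (ZMod 2 × ZMod 2)) := by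
  have ha1 : a ≠ 1 := fun h => ha' 1 (by simp [h])
  have hb1 : b ≠ 1 := fun h => hb' 1 (by simp [h])
  have hab1 : a * b ≠ 1 := fun h => hab 1 (by simp [h])
  have hne : a ≠ b := fun h => hab1 (by rw [h, ← pow_two, hb])
  have hpow : ∀ x : G, (∃ k : ℕ, x ^ 2 ^ k = 1) → x ^ 2 = 1 := by
    rintro x ⟨k, hk⟩
    induction k generalizing x with
    | zero => simp_all
    | succ k ih =>
      have h4 : (x ^ 2) ^ 2 = 1 := ih (x ^ 2) (by rw [← pow_mul, ← pow_succ']; exact hk)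
      rcases h _ h4 with h0 | h0 | h0 | h0
      · exact h0
      · exact absurd h0 (ha' x)
      · exact absurd h0 (hb' x)
      · exact absurd h0 (hab x)
  have hmem : ∀ x : G, x ∈ P ↔ x ^ 2 = 1 := by
    intro x
    constructor
    · intro hx
      obtain ⟨k, hk⟩ := P.isPGroup' ⟨x, hx⟩
      exact hpow x ⟨k, by simpa using congrArg Subtype.val hk⟩
    · intro hx
      have hz : IsPGroup 2 (Subgroup.zpowers x) := by
        rw [IsPGroup.iff_orderOf]
        rintro ⟨y, n, rfl⟩
        refine (Nat.dvd_prime_pow Nat.prime_two (m := 1)).1 ?_ |>.imp fun k hk => hk.2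
        rw [pow_one, orderOf_dvd_iff_pow_eq_one]
        ext
        change (x ^ n) ^ 2 = 1
        rw [← zpow_natCast, ← zpow_mul, mul_comm, zpow_mul, zpow_natCast, hx, one_zpow]
      exact hz.le_sylow_of_normal P (Subgroup.mem_zpowers x)
  have hset : (P : Set G) = {1, a, b, a * b} := by
    ext x
    simp only [Set.mem_insert_iff, Set.mem_singleton_iff, SetLike.mem_coe]
    refine (hmem x).trans ⟨h x, ?_⟩
    rintro (rfl | rfl | rfl | rfl)
    · simp
    · exact ha
    · exact hb
    · rw [mul_pow, ha, hb, one_mul]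
  have hcard : Nat.card P = 4 := by
    change Nat.card (P : Set G) = 4
    rw [hset, Nat.card_coe_set_eq]
    have h1 : a ≠ a * b := by simpa using hb1
    have h2 : b ≠ a * b := by simpa using ha1
    rw [Set.ncard_insert_of_notMem (by simp [ha1.symm, hb1.symm, hab1.symm]),
      Set.ncard_insert_of_notMem (by simp [hne, hb1]),
      Set.ncard_insert_of_notMem (by simp [ha1]), Set.ncard_singleton]
  have hexp : Monoid.exponent P = 2 := by
    refine (Nat.dvd_prime Nat.prime_two).1 (Monoid.exponent_dvd_of_forall_pow_eq_one
      fun x => Subtype.ext ((hmem x).1 x.2)) |>.resolve_left fun h1 => ?_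
    have := Monoid.exp_eq_one_iff.1 h1
    exact absurd (hcard.symm.trans (Nat.card_of_subsingleton (1 : P))) (by norm_num)
  have : IsKleinFour P := ⟨hcard, hexp⟩
  exact IsKleinFour.nonempty_mulEquiv

section GaussianIntegers

/-- `n` is not a nonzero norm, up to squares, from the quadratic extension `ℚ(i)(√d)` of `ℚ(i)`. -/
def GaussianInt.IsNormFree (d n : GaussianInt) : Prop :=
  ∀ a b c : GaussianInt, d * a ^ 2 - b ^ 2 = n * d * c ^ 2 → c = 0

open GaussianInt

theorem GaussianInt.isNormFree_of_prime {ρ e n : GaussianInt} (hρ : Prime ρ) (he : ¬ ρ ∣ e)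
    (H : ∀ x y, ρ ∣ x ^ 2 - n * y ^ 2 → ρ ∣ y) : IsNormFree (ρ * e) n := by
  have key : ∀ k : ℕ, ∀ a b c : GaussianInt,
      ρ * e * a ^ 2 - b ^ 2 = n * (ρ * e) * c ^ 2 → ρ ^ k ∣ c := by
    intro k
    induction k with
    | zero => intro a b c _; simp
    | succ k ih =>
      intro a b c h
      have hb : ρ ∣ b := hρ.dvd_of_dvd_pow (n := 2)
        ⟨e * a ^ 2 - n * e * c ^ 2, by linear_combination -h⟩
      obtain ⟨b, rfl⟩ := hb
      have h1 : e * (a ^ 2 - n * c ^ 2) = ρ * b ^ 2 := by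
        apply mul_left_cancel₀ hρ.ne_zero
        linear_combination h
      have h2 : ρ ∣ a ^ 2 - n * c ^ 2 := (hρ.dvd_or_dvd ⟨_, h1⟩).resolve_left he
      obtain ⟨c, rfl⟩ := H _ _ h2
      have ha : ρ ∣ a := by
        refine hρ.dvd_of_dvd_pow (n := 2) ?_
        have := dvd_add h2 (⟨n * ρ * c ^ 2, by ring⟩ : ρ ∣ n * (ρ * c) ^ 2)
        simpa using this
      obtain ⟨a, rfl⟩ := ha
      have hb : ρ ∣ b := hρ.dvd_of_dvd_pow (n := 2)
        ⟨e * a ^ 2 - n * e * c ^ 2, by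
          apply mul_left_cancel₀ hρ.ne_zero
          linear_combination -h1⟩
      obtain ⟨b, rfl⟩ := hb
      rw [pow_succ']
      refine mul_dvd_mul_left _ (ih a (ρ * b) c ?_)
      apply mul_left_cancel₀ (pow_ne_zero 2 hρ.ne_zero)
      linear_combination h
  intro a b c h
  by_contra hc
  obtain ⟨k, hk⟩ := FiniteMultiplicity.of_prime_left hρ hc
  exact hk (key _ a b c h)

theorem GaussianInt.IsNormFree.mul_left {ρ e n : GaussianInt} (hρ : ρ ≠ 0)
    (h : IsNormFree (ρ * e) (-(e * n))) : IsNormFree (ρ * e) (ρ * n) := by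
  intro a b c habc
  have := h b (ρ * e * a) (ρ * c) (by linear_combination -(ρ * e) * habc)
  exact (mul_eq_zero.1 this).resolve_left hρ

theorem GaussianInt.dvd_of_legendreSym_norm_eq_neg_one {q : ℕ} [Fact q.Prime] {n : GaussianInt}
    (hq : q % 4 = 3) (hn : legendreSym q n.norm = -1) (x y : GaussianInt)
    (h : (q : GaussianInt) ∣ x ^ 2 - n * y ^ 2) : (q : GaussianInt) ∣ y := by
  have h1 : ((x ^ 2 : GaussianInt).norm : ZMod q) = (n * y ^ 2 : GaussianInt).norm := by
    obtain ⟨z, hz⟩ := h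
    have hx : x ^ 2 = n * y ^ 2 + q * z := by linear_combination hz
    rw [hx]
    simp [Zsqrtd.norm_def]
  have h2 : ((x.norm : ℤ) : ZMod q) ^ 2 - (n.norm : ℤ) * ((y.norm : ℤ) : ZMod q) ^ 2 = 0 := by
    simp only [pow_two, Zsqrtd.norm_mul, Int.cast_mul] at h1 ⊢
    linear_combination h1
  have h3 := (legendreSym.eq_zero_mod_of_eq_neg_one hn h2).2
  rw [Zsqrtd.norm_def] at h3
  have h4 : ((y.re : ℤ) : ZMod q) ^ 2 = -((y.im : ℤ) : ZMod q) ^ 2 := by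
    push_cast at h3
    linear_combination h3
  have hre : ((y.re : ℤ) : ZMod q) = 0 := by
    by_contra h0
    exact ZMod.mod_four_ne_three_of_sq_eq_neg_sq h0 h4 hq
  have him : ((y.im : ℤ) : ZMod q) = 0 := by
    rw [hre] at h4
    simpa using h4.symm
  rw [ZMod.intCast_zmod_eq_zero_iff_dvd _ _] at hre him
  exact (Zsqrtd.intCast_dvd (q : ℤ) y).2 ⟨hre, him⟩

/-- A rational prime `p ≡ 1 mod 4` splits in the Gaussian integers. -/
theorem GaussianInt.exists_ringHom_zmod {p : ℕ} [Fact p.Prime] (hp : p % 4 = 1) :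
    ∃ (π : GaussianInt) (ψ : GaussianInt →+* ZMod p), π * star π = p ∧
      (∀ z, ψ z = 0 ↔ π ∣ z) ∧ ψ (star π) ≠ 0 := by
  obtain ⟨a, b, hab⟩ := Nat.Prime.sq_add_sq (p := p) (by omega)
  have hpp : p.Prime := Fact.out
  have hab' : ((a : ℤ) : ZMod p) ^ 2 + ((b : ℤ) : ZMod p) ^ 2 = 0 := by
    have := congrArg (Nat.cast : ℕ → ZMod p) hab
    push_cast at this ⊢
    rw [this, ZMod.natCast_self]
  have h2 : (2 : ZMod p) ≠ 0 := by
    intro h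
    have : (p : ℕ) ∣ 2 := (ZMod.natCast_eq_zero_iff 2 p).1 (by exact_mod_cast h)
    have := Nat.le_of_dvd two_pos this
    have := hpp.two_le
    omega
  have ha : ((a : ℤ) : ZMod p) ≠ 0 := by
    intro h
    have h1 : p ∣ a := (ZMod.natCast_eq_zero_iff a p).1 (by exact_mod_cast h)
    rw [h] at hab'
    have h2 : p ∣ b := (ZMod.natCast_eq_zero_iff b p).1 (by
      have : ((b : ℤ) : ZMod p) = 0 := by simpa using hab'
      exact_mod_cast this)
    have h3 : p ^ 2 ∣ p := by
      conv_rhs => rw [← hab]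
      exact dvd_add (pow_dvd_pow_of_dvd h1 2) (pow_dvd_pow_of_dvd h2 2)
    have := Nat.le_of_dvd hpp.pos h3
    nlinarith [hpp.two_le]
  have hb : ((b : ℤ) : ZMod p) ≠ 0 := by
    intro h
    rw [h] at hab'
    exact ha (by simpa using hab')
  set A : ZMod p := ((a : ℤ) : ZMod p) with hA
  set B : ZMod p := ((b : ℤ) : ZMod p) with hB
  have hr : (-A / B) * (-A / B) = ((-1 : ℤ) : ZMod p) := by
    field_simp
    push_cast
    linear_combination hab'
  have hbr : B * (-A / B) = -A := by field_simp
  refine ⟨⟨a, b⟩, Zsqrtd.lift ⟨-A / B, hr⟩, ?_, ?_, ?_⟩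
  · have : ((p : ℕ) : GaussianInt) = ((p : ℤ) : GaussianInt) := by simp
    rw [← Zsqrtd.norm_eq_mul_conj, this]
    congr 1
    rw [← hab]
    simp [Zsqrtd.norm_def]
    ring
  · intro z
    constructor
    · intro hz
      have hz' : ((z.re : ℤ) : ZMod p) + (z.im : ℤ) * (-A / B) = 0 := hz
      have e1 : ((z.re : ℤ) : ZMod p) * B - (z.im : ℤ) * A = 0 := by
        linear_combination B * hz' - (z.im : ZMod p) * hbr
      have e2 : ((z.re : ℤ) : ZMod p) * A + (z.im : ℤ) * B = 0 := by
        apply mul_left_cancel₀ hb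
        linear_combination A * e1 + (z.im : ZMod p) * hab'
      have d1 : (p : ℤ) ∣ z.re * b - z.im * a :=
        (ZMod.intCast_zmod_eq_zero_iff_dvd _ _).1 (by push_cast; simpa [hA, hB] using e1)
      have d2 : (p : ℤ) ∣ z.re * a + z.im * b :=
        (ZMod.intCast_zmod_eq_zero_iff_dvd _ _).1 (by push_cast; simpa [hA, hB] using e2)
      have d3 : ((p : ℤ) : GaussianInt) ∣ star (⟨a, b⟩ : GaussianInt) * z := by
        rw [Zsqrtd.intCast_dvd]
        constructor
        · simpa [mul_comm, add_comm] using d2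
        · have := (dvd_neg (a := (p : ℤ))).2 d1
          simpa [mul_comm, add_comm, sub_eq_add_neg] using this
      have hp' : ((p : ℤ) : GaussianInt) = star (⟨a, b⟩ : GaussianInt) * ⟨a, b⟩ := by
        rw [mul_comm, ← Zsqrtd.norm_eq_mul_conj]
        congr 1
        rw [← hab]
        simp [Zsqrtd.norm_def]
        ring
      rw [hp'] at d3
      refine (mul_dvd_mul_iff_left ?_).1 d3
      intro h0
      rw [h0, zero_mul, Int.cast_natCast, Nat.cast_eq_zero] at hp'
      exact hpp.ne_zero hp'
    · rintro ⟨w, rfl⟩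
      rw [map_mul]
      have : Zsqrtd.lift ⟨-A / B, hr⟩ (⟨a, b⟩ : GaussianInt) = 0 := by
        change A + B * (-A / B) = 0
        rw [hbr]; ring
      rw [this, zero_mul]
  · change A + ((-(b : ℤ) : ℤ) : ZMod p) * (-A / B) ≠ 0
    intro h
    have : 2 * A = 0 := by
      push_cast at h hbr
      simp only [hB] at *
      push_cast at *
      linear_combination h + hbr
    exact (mul_ne_zero h2 ha) this

end GaussianIntegers

section SplitPrime

open GaussianInt

variable {p q : ℕ} [Fact p.Prime] [Fact q.Prime]

theorem GaussianInt.prime_of_ker_eq {ρ : GaussianInt} (hρ : ρ ≠ 0) {ψ : GaussianInt →+* ZMod p}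
    (h : ∀ z, ψ z = 0 ↔ ρ ∣ z) : Prime ρ := by
  refine ⟨hρ, fun hu => ?_, fun a b hab => ?_⟩
  · have := (h 1).2 hu.dvd
    simp at this
  · rw [← h, ← h, ← mul_eq_zero, ← map_mul, h]
    exact hab

theorem GaussianInt.dvd_of_not_isSquare {ρ n : GaussianInt} {ψ : GaussianInt →+* ZMod p}
    (h : ∀ z, ψ z = 0 ↔ ρ ∣ z) (hn : ¬ IsSquare (ψ n)) (x y : GaussianInt)
    (hxy : ρ ∣ x ^ 2 - n * y ^ 2) : ρ ∣ y := by
  rw [← h] at hxy ⊢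
  by_contra hy
  simp only [map_sub, map_mul, map_pow] at hxy
  refine hn ⟨ψ x / ψ y, ?_⟩
  field_simp
  linear_combination -hxy

theorem GaussianInt.map_mul_map_star (ψ : GaussianInt →+* ZMod p) (z : GaussianInt) :
    ψ z * ψ (star z) = ((z.norm : ℤ) : ZMod p) := by
  rw [← map_mul, ← Zsqrtd.norm_eq_mul_conj, map_intCast]

theorem GaussianInt.isNormFree_of_legendreSym (hp : p % 8 = 5) (hq : q % 8 = 3)
    {n : GaussianInt} (hn : legendreSym q n.norm = -1) :
    IsNormFree (2 * p * q) n := by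
  have hqp : Prime (q : GaussianInt) := prime_of_nat_prime_of_mod_four_eq_three q (by omega)
  have hpP : p.Prime := Fact.out
  have hqP : q.Prime := Fact.out
  rw [mul_comm]
  refine isNormFree_of_prime hqp (fun h => ?_)
    (dvd_of_legendreSym_norm_eq_neg_one (by omega) hn)
  have h1 : (((q : ℕ) : ℤ) : GaussianInt) ∣ ((2 * p : ℤ) : GaussianInt) := by
    push_cast
    exact h
  rw [Zsqrtd.intCast_dvd_intCast] at h1
  have h2 : q ∣ 2 * p := by exact_mod_cast h1
  rcases (Nat.Prime.dvd_mul hqP).1 h2 with h3 | h3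
  · have := (Nat.prime_dvd_prime_iff_eq hqP Nat.prime_two).1 h3
    omega
  · have := (Nat.prime_dvd_prime_iff_eq hqP hpP).1 h3
    omega

variable {π : GaussianInt} {ψ : GaussianInt →+* ZMod p}

theorem GaussianInt.map_two_ne_zero (hp : p % 8 = 5) : (2 : ZMod p) ≠ 0 := by
  intro h
  have : p ∣ 2 := (ZMod.natCast_eq_zero_iff 2 p).1 (by exact_mod_cast h)
  have := Nat.le_of_dvd two_pos this
  omega

theorem GaussianInt.natCast_ne_zero_of_mod (hp : p % 8 = 5) (hq : q % 8 = 3) :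
    (q : ZMod p) ≠ 0 := by
  intro h
  have := (Nat.prime_dvd_prime_iff_eq Fact.out Fact.out).1 ((ZMod.natCast_eq_zero_iff q p).1 h)
  omega

theorem GaussianInt.isNormFree_of_not_isSquare (hp : p % 8 = 5) (hq : q % 8 = 3)
    (hπ : π * star π = p) (hψ : ∀ z, ψ z = 0 ↔ π ∣ z) (hψ' : ψ (star π) ≠ 0)
    {n : GaussianInt} (hn : ¬ IsSquare (ψ n)) : IsNormFree (2 * p * q) n := by
  have hd : (2 * p * q : GaussianInt) = π * (2 * star π * q) := by
    rw [← hπ]; ring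
  have hp0 : (p : GaussianInt) ≠ 0 := by exact_mod_cast (Fact.out : p.Prime).ne_zero
  rw [hd]
  refine isNormFree_of_prime (prime_of_ker_eq (by rintro rfl; simp_all) hψ) ?_
    (dvd_of_not_isSquare hψ hn)
  rw [← hψ]
  simp only [map_mul, map_ofNat, map_natCast]
  exact mul_ne_zero (mul_ne_zero (map_two_ne_zero hp) hψ') (natCast_ne_zero_of_mod hp hq)

theorem GaussianInt.not_isSquare_map_of_sq (hp : p % 8 = 5) {u : GaussianInt} (hu : u ^ 2 = -1) :
    ¬ IsSquare (ψ u) := by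
  rintro ⟨r, hr⟩
  have h1 : ψ u ^ 2 = -1 := by rw [← map_pow, hu, map_neg, map_one]
  have h0 : r ≠ 0 := by
    rintro rfl
    rw [hr] at h1
    simp at h1
  refine absurd ?_ (show ¬ IsSquare (2 : ZMod p) by
    rw [ZMod.exists_sq_eq_two_iff (by omega)]
    omega)
  refine ⟨(1 + ψ u) / r, ?_⟩
  field_simp
  linear_combination -h1 - 2 * hr

theorem GaussianInt.isNormFree_mul (hp : p % 8 = 5) (hq : q % 8 = 3)
    (hπ : π * star π = p) (hψ : ∀ z, ψ z = 0 ↔ π ∣ z) (hψ' : ψ (star π) ≠ 0)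
    {ν : GaussianInt} (hν : quadraticChar (ZMod p) (ν.norm * q : ZMod p) = 1) :
    IsNormFree (2 * p * q) (π * ν) := by
  have hp0 : (p : GaussianInt) ≠ 0 := by exact_mod_cast (Fact.out : p.Prime).ne_zero
  have hπ0 : π ≠ 0 := by rintro rfl; simp_all
  have hψs : ∀ z, (ψ.comp (starRingEnd GaussianInt)) z = 0 ↔ star π ∣ z := by
    intro z
    change ψ (star z) = 0 ↔ _
    rw [hψ]
    constructor
    · rintro ⟨w, hw⟩
      exact ⟨star w, by rw [← star_star z, hw, star_mul, mul_comm]⟩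
    · rintro ⟨w, rfl⟩
      exact ⟨star w, by rw [star_mul, star_star, mul_comm]⟩
  by_cases hs : IsSquare (ψ (star (π * ν)))
  · have hd : (2 * p * q : GaussianInt) = π * (2 * star π * q) := by
      rw [← hπ]; ring
    rw [hd]
    apply IsNormFree.mul_left hπ0
    rw [← hd]
    refine isNormFree_of_not_isSquare hp hq hπ hψ hψ' ?_
    have hνq : ((ν.norm : ℤ) : ZMod p) * q ≠ 0 := by
      intro h
      rw [h] at hν
      simp at hν
    have hν0 := hνq
    rw [← map_mul_map_star ψ] at hν0 hν
    have e1 : ψ ν ≠ 0 := left_ne_zero_of_mul (left_ne_zero_of_mul hν0)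
    have e2 : ψ (star ν) ≠ 0 := right_ne_zero_of_mul (left_ne_zero_of_mul hν0)
    obtain ⟨s, hs⟩ := hs
    rw [star_mul, map_mul] at hs
    rw [quadraticChar_one_iff_isSquare hν0] at hν
    obtain ⟨t, ht⟩ := hν
    have hm1 : IsSquare (-1 : ZMod p) := by
      rw [ZMod.exists_sq_eq_neg_one_iff]
      omega
    obtain ⟨v, hv⟩ := hm1
    rintro ⟨w, hw⟩
    simp only [map_mul, map_neg, map_ofNat, map_natCast] at hw
    have hs0 : s ≠ 0 := by
      rintro rfl
      simp_all
    have hq0 := natCast_ne_zero_of_mod hp hq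
    have ht0 : t ≠ 0 := by
      rintro rfl
      simp_all
    refine absurd ?_ (show ¬ IsSquare (2 : ZMod p) by
      rw [ZMod.exists_sq_eq_two_iff (by omega)]
      omega)
    refine ⟨v * w * ψ (star ν) / (s * t), ?_⟩
    field_simp
    linear_combination (-2 * s ^ 2) * ht + (-2 * ψ ν * ψ (star ν) * q) * hs +
      ψ (star ν) ^ 2 * v ^ 2 * hw - (2 * ψ (star π) * q * ψ ν * ψ (star ν) ^ 2) * hv
  · have hd : (2 * p * q : GaussianInt) = star π * (2 * π * q) := by
      rw [← hπ]; ring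
    rw [hd]
    refine isNormFree_of_prime (prime_of_ker_eq (by simpa using hπ0) hψs) ?_
      (dvd_of_not_isSquare hψs hs)
    rw [← hψs]
    simp only [map_mul, map_ofNat, map_natCast]
    exact mul_ne_zero (mul_ne_zero (map_two_ne_zero hp) hψ') (natCast_ne_zero_of_mod hp hq)

end SplitPrime

section PellDescent

theorem Pell.exists_mul_sq_eq_mul_sq_add_one {D : ℕ} (hD : D % 4 = 2) :
    ∃ A B s t : ℕ, A * B = D ∧ B * t ^ 2 = A * s ^ 2 + 1 ∧ B ≠ 1 := by
  have hns : ¬ IsSquare (D : ℤ) := by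
    rintro ⟨r, hr⟩
    have h1 : (D : ℤ) % 4 = 2 := by omega
    rw [hr] at h1
    rcases Int.emod_two_eq_zero_or_one r with h | h <;>
    · obtain ⟨k, hk⟩ : ∃ k, r = 2 * k + r % 2 := ⟨r / 2, by omega⟩
      rw [h] at hk
      rw [hk] at h1
      ring_nf at h1
      omega
  obtain ⟨a, ha⟩ := Pell.IsFundamental.exists_of_not_isSquare (by omega) hns
  have hprop := a.prop
  obtain ⟨hx, hy, hmin⟩ := ha
  have hmin := fun b => @hmin b
  set x := a.x
  set y := a.y
  have hodd : x % 2 = 1 := by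
    by_contra h
    obtain ⟨k, hk⟩ : ∃ k, x = 2 * k := ⟨x / 2, by omega⟩
    obtain ⟨e, he⟩ : ∃ e, D = 2 * e := ⟨D / 2, by omega⟩
    rw [hk, he] at hprop
    push_cast at hprop
    ring_nf at hprop
    omega
  obtain ⟨m, hm⟩ : ∃ m, x = 2 * m + 1 := ⟨x / 2, by omega⟩
  have heven : y % 2 = 0 := by
    by_contra h
    obtain ⟨k, hk⟩ : ∃ k, y = 2 * k + 1 := ⟨y / 2, by omega⟩
    obtain ⟨e, he⟩ : ∃ e : ℤ, (D : ℤ) = 4 * e + 2 := ⟨D / 4, by omega⟩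
    rw [hk, hm, he] at hprop
    ring_nf at hprop
    omega
  obtain ⟨z, hz⟩ : ∃ z, y = 2 * z := ⟨y / 2, by omega⟩
  lift m to ℕ using by omega
  lift z to ℕ using by omega
  have hm0 : 0 < m := by omega
  have hz0 : 0 < z := by omega
  have hmz : m * (m + 1) = D * z ^ 2 := by
    rw [hm, hz] at hprop
    zify
    linarith
  have hcop : Nat.Coprime m (m + 1) := by simp
  have hDpos : 0 < D := by omega
  have hAB : m.gcd D * (m + 1).gcd D = D := by
    rw [Nat.gcd_comm m, Nat.gcd_comm (m + 1), ← Nat.Coprime.gcd_mul _ hcop, hmz]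
    simp
  obtain ⟨m', hm'⟩ := Nat.gcd_dvd_left m D
  obtain ⟨n', hn'⟩ := Nat.gcd_dvd_left (m + 1) D
  have hsq : m' * n' = z ^ 2 := by
    apply Nat.eq_of_mul_eq_mul_left hDpos
    calc D * (m' * n') = (m.gcd D * m') * ((m + 1).gcd D * n') := by
          nth_rewrite 1 [← hAB]
          ring
      _ = D * z ^ 2 := by rw [← hm', ← hn', hmz]
  have hcop' : Nat.Coprime m' n' :=
    (hcop.coprime_dvd_left ⟨_, hm'.trans (mul_comm _ _)⟩).coprime_dvd_right
      ⟨_, hn'.trans (mul_comm _ _)⟩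
  obtain ⟨s, hs⟩ := exists_eq_pow_of_mul_eq_pow (by rw [gcd_eq_nat_gcd, hcop']; simp) hsq
  obtain ⟨t, ht⟩ := exists_eq_pow_of_mul_eq_pow (a := n') (b := m') (c := z) (k := 2)
    (by rw [gcd_eq_nat_gcd, Nat.gcd_comm, hcop']; simp) (by rw [mul_comm, hsq])
  have heq : (m + 1).gcd D * t ^ 2 = m.gcd D * s ^ 2 + 1 := by
    rw [← hs, ← ht, ← hm', ← hn']
  refine ⟨m.gcd D, (m + 1).gcd D, s, t, hAB, heq, fun hB => ?_⟩
  rw [hB, mul_one] at hAB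
  rw [hB, hAB, one_mul] at heq
  rw [hAB] at hm'
  have hs0 : s ≠ 0 := by
    rintro rfl
    simp [hs] at hm'
    omega
  have ht1 : 1 < t := by
    have : 0 < D * s ^ 2 := by positivity
    by_contra h
    have : t ^ 2 ≤ 1 := by nlinarith
    omega
  have hle := hmin (Pell.Solution₁.mk (t : ℤ) s (by
    have := congrArg (Nat.cast : ℕ → ℤ) heq
    push_cast at this
    linarith)) (by simpa using ht1)
  rw [Pell.Solution₁.x_mk] at hle
  have h1 : x = 2 * (t : ℤ) ^ 2 - 1 := by
    rw [hm, hm', hs]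
    have := congrArg (Nat.cast : ℕ → ℤ) heq
    push_cast at this ⊢
    linarith
  have : (1 : ℤ) < t := by exact_mod_cast ht1
  nlinarith

theorem Pell.exists_sq_eq_one_of_mod_eight {p q : ℕ} [Fact p.Prime] [Fact q.Prime]
    (hp : p % 8 = 5) (hq : q % 8 = 3) :
    ∃ t s : ℤ, (p * t ^ 2 - 2 * q * s ^ 2) ^ 2 = 1 ∨ (q * t ^ 2 - 2 * p * s ^ 2) ^ 2 = 1 := by
  have hpP : p.Prime := Fact.out
  have hqP : q.Prime := Fact.out
  have hD : (2 * p * q) % 4 = 2 := by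
    rw [Nat.mul_mod, Nat.mul_mod 2 p, show p % 4 = 1 by omega, show q % 4 = 3 by omega]
  obtain ⟨A, B, s, t, hAB, heq, hB1⟩ := Pell.exists_mul_sq_eq_mul_sq_add_one hD
  have hdvd : A ∣ 2 * p * q := ⟨B, hAB.symm⟩
  obtain ⟨A', A₃, hA', hA₃, rfl⟩ := (Nat.dvd_mul).1 hdvd
  obtain ⟨A₁, A₂, hA₁, hA₂, rfl⟩ := (Nat.dvd_mul).1 hA'
  rw [Nat.dvd_prime Nat.prime_two] at hA₁
  rw [Nat.dvd_prime hpP] at hA₂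
  rw [Nat.dvd_prime hqP] at hA₃
  have hp0 := hpP.pos
  have hq0 := hqP.pos
  have n2 : ¬ IsSquare (2 : ZMod p) := by
    rw [ZMod.exists_sq_eq_two_iff (by omega)]
    omega
  have n2' : ¬ IsSquare (-2 : ZMod p) := by
    rw [ZMod.exists_sq_eq_neg_two_iff (by omega)]
    omega
  have n1 : ¬ IsSquare (-1 : ZMod q) := by
    rw [ZMod.exists_sq_eq_neg_one_iff]
    omega
  have heqp := congrArg (Nat.cast : ℕ → ZMod p) heq
  have heqq := congrArg (Nat.cast : ℕ → ZMod q) heq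
  have heqz := congrArg (Nat.cast : ℕ → ℤ) heq
  rcases hA₁ with h₁ | h₁ <;> rcases hA₂ with h₂ | h₂ <;> rcases hA₃ with h₃ | h₃ <;>
    rw [h₁, h₂, h₃] at hAB heqp heqq heqz
  · have hB : B = 2 * p * q := by linarith
    exfalso
    apply n1
    rw [hB] at heqq
    push_cast at heqq
    simp only [CharP.cast_eq_zero, mul_zero, zero_mul] at heqq
    exact ⟨s, by linear_combination heqq⟩
  · have hB : B = 2 * p := by
      apply Nat.eq_of_mul_eq_mul_left hq0; linarith
    refine ⟨s, t, Or.inr ?_⟩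
    rw [hB] at heqz
    push_cast at heqz
    rw [show (q * s ^ 2 - 2 * p * t ^ 2 : ℤ) = -1 by linarith]
    norm_num
  · have hB : B = 2 * q := by
      apply Nat.eq_of_mul_eq_mul_left hp0; linarith
    refine ⟨s, t, Or.inl ?_⟩
    rw [hB] at heqz
    push_cast at heqz
    rw [show (p * s ^ 2 - 2 * q * t ^ 2 : ℤ) = -1 by linarith]
    norm_num
  · have hB : B = 2 := by
      apply Nat.eq_of_mul_eq_mul_left (Nat.mul_pos hp0 hq0); linarith
    exfalso
    rw [hB] at heqp
    push_cast at heqp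
    simp only [CharP.cast_eq_zero, mul_zero, zero_mul] at heqp
    exact n2 ⟨2 * t, by linear_combination -2 * heqp⟩
  · have hB : B = p * q := by linarith
    exfalso
    rw [hB] at heqp
    push_cast at heqp
    simp only [CharP.cast_eq_zero, zero_mul] at heqp
    exact n2' ⟨2 * s, by linear_combination 2 * heqp⟩
  · have hB : B = p := by
      apply Nat.eq_of_mul_eq_mul_left (Nat.mul_pos two_pos hq0); linarith
    refine ⟨t, s, Or.inl ?_⟩
    rw [hB] at heqz
    push_cast at heqz
    rw [show (p * t ^ 2 - 2 * q * s ^ 2 : ℤ) = 1 by linarith]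
    norm_num
  · have hB : B = q := by
      apply Nat.eq_of_mul_eq_mul_left (Nat.mul_pos two_pos hp0); linarith
    refine ⟨t, s, Or.inr ?_⟩
    rw [hB] at heqz
    push_cast at heqz
    rw [show (q * t ^ 2 - 2 * p * s ^ 2 : ℤ) = 1 by linarith]
    norm_num
  · refine absurd ?_ hB1
    apply Nat.eq_of_mul_eq_mul_left (Nat.mul_pos (Nat.mul_pos two_pos hp0) hq0); linarith

end PellDescent

section IdealClasses

/-- The class of an ideal in the class group, with value `1` at the zero ideal. -/
noncomputable def ClassGroup.ofIdeal {O : Type*} [CommRing O] [IsDedekindDomain O]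
    (I : Ideal O) : ClassGroup O :=
  open Classical in
  if h : I = ⊥ then 1 else ClassGroup.mk0 ⟨I, mem_nonZeroDivisors_of_ne_zero h⟩

variable {O : Type*} [CommRing O] [IsDedekindDomain O]

theorem ClassGroup.ofIdeal_mul {I J : Ideal O} (hI : I ≠ ⊥) (hJ : J ≠ ⊥) :
    ofIdeal (I * J) = ofIdeal I * ofIdeal J := by
  have hIJ : I * J ≠ ⊥ := mul_ne_zero hI hJ
  rw [ofIdeal, ofIdeal, ofIdeal, dif_neg hI, dif_neg hJ, dif_neg hIJ, ← map_mul]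
  rfl

theorem ClassGroup.ofIdeal_eq_one_iff {I : Ideal O} : ofIdeal I = 1 ↔ ∃ x, I = Ideal.span {x} := by
  rw [ofIdeal]
  split_ifs with h
  · simp only [true_iff]
    exact ⟨0, by simp [h]⟩
  · rw [ClassGroup.mk0_eq_one_iff]
    exact Submodule.isPrincipal_iff _

theorem ClassGroup.ofIdeal_span_singleton (x : O) : ofIdeal (Ideal.span {x}) = 1 :=
  ofIdeal_eq_one_iff.2 ⟨x, rfl⟩

theorem ClassGroup.exists_ofIdeal_eq (x : ClassGroup O) : ∃ I : Ideal O, I ≠ ⊥ ∧ ofIdeal I = x := by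
  obtain ⟨I, rfl⟩ := ClassGroup.mk0_surjective x
  have h : (I : Ideal O) ≠ ⊥ := nonZeroDivisors.coe_ne_zero I
  exact ⟨I, h, by rw [ofIdeal, dif_neg h]⟩

theorem Ideal.sq_injective {I J : Ideal O} (h : I ^ 2 = J ^ 2) : I = J :=
  le_antisymm
    (Ideal.dvd_iff_le.1 ((UniqueFactorizationMonoid.pow_dvd_pow_iff_dvd two_ne_zero).1 h.symm.dvd))
    (Ideal.dvd_iff_le.1 ((UniqueFactorizationMonoid.pow_dvd_pow_iff_dvd two_ne_zero).1 h.dvd))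

theorem Ideal.span_pair_sq_of_isCoprime {R : Type*} [CommRing R] {r y w : R}
    (hy : y ^ 2 = r * w) (h : IsCoprime r w) :
    Ideal.span {r, y} ^ 2 = Ideal.span {r} := by
  apply le_antisymm
  · rw [pow_two, Ideal.span_pair_mul_span_pair, Ideal.span_le]
    rintro x (rfl | rfl | rfl | rfl) <;>
      rw [SetLike.mem_coe, Ideal.mem_span_singleton]
    · exact dvd_mul_left _ _
    · exact dvd_mul_right _ _
    · exact dvd_mul_left _ _
    · exact ⟨w, by rw [← hy, pow_two]⟩
  · rw [Ideal.span_singleton_le_iff_mem]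
    obtain ⟨a, b, hab⟩ := h
    have hr : r ∈ Ideal.span {r, y} := Ideal.subset_span (by simp)
    have hy' : y ∈ Ideal.span {r, y} := Ideal.subset_span (by simp)
    have hmem := add_mem (Ideal.mul_mem_left _ a (Ideal.pow_mem_pow hr 2))
      (Ideal.mul_mem_left _ b (Ideal.pow_mem_pow hy' 2))
    have e : a * r ^ 2 + b * y ^ 2 = r := by linear_combination r * hab + b * hy
    rwa [e] at hmem

/-- A ring with an involution whose ring of fixed points is the ring of Gaussian integers. -/
structure GaussianInvolution (O : Type*) [CommRing O] where
  /-- The inclusion of the Gaussian integers. -/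
  φ : GaussianInt →+* O
  /-- The involution. -/
  σ : O ≃+* O
  injective : Function.Injective φ
  map_φ : ∀ z, σ (φ z) = φ z
  invol : ∀ x, σ (σ x) = x
  exists_of_fixed : ∀ x, σ x = x → ∃ z, φ z = x

namespace GaussianInvolution

section CommRing

variable {O : Type*} [CommRing O] (S : GaussianInvolution O)

theorem φ_eq_zero {z : GaussianInt} : S.φ z = 0 ↔ z = 0 := map_eq_zero_iff S.φ S.injective

theorem exists_norm (x : O) : ∃ n, S.φ n = x * S.σ x :=
  S.exists_of_fixed _ (by rw [map_mul, S.invol, mul_comm])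

theorem exists_trace (x : O) : ∃ t, S.φ t = x + S.σ x :=
  S.exists_of_fixed _ (by rw [map_add, S.invol, add_comm])

theorem map_σ_ne_bot {I : Ideal O} (hI : I ≠ ⊥) : I.map S.σ ≠ ⊥ := by
  rwa [Ne, Ideal.map_eq_bot_iff_of_injective S.σ.injective]

theorem map_span_φ (c : GaussianInt) :
    (Ideal.span {S.φ c}).map S.σ = Ideal.span {S.φ c} := by
  rw [Ideal.map_span, Set.image_singleton]
  congr 2
  exact S.map_φ c

variable {δ : O} {d : GaussianInt}

theorem eq_zero_of_isNormFree (hσδ : S.σ δ = -δ) (hδ : δ ^ 2 = S.φ d) {n c : GaussianInt}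
    (hn : GaussianInt.IsNormFree d n) {α : O} (h : α * S.σ α = S.φ (n * c ^ 2)) : c = 0 := by
  obtain ⟨a, ha⟩ := S.exists_trace α
  obtain ⟨b, hb⟩ := S.exists_trace (δ * α)
  have h2 := hn a b (2 * c) (S.injective ?_)
  · rcases mul_eq_zero.1 h2 with h2 | h2
    · exact absurd h2 two_ne_zero
    · exact h2
  · rw [map_mul, hσδ] at hb
    rw [map_mul, map_pow] at h
    simp only [map_sub, map_mul, map_pow, ha, hb, ← hδ, map_ofNat]
    linear_combination 4 * δ ^ 2 * h

end CommRing

variable (S : GaussianInvolution O) {δ : O} {d : GaussianInt}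

theorem φ_dvd_φ {a b : GaussianInt} : S.φ a ∣ S.φ b ↔ a ∣ b := by
  refine ⟨?_, map_dvd S.φ⟩
  rintro ⟨x, hx⟩
  rcases eq_or_ne a 0 with rfl | ha
  · rw [map_zero, zero_mul, S.φ_eq_zero] at hx
    rw [hx]
  have h := congrArg S.σ hx
  rw [map_mul, S.map_φ, S.map_φ, hx] at h
  have h := mul_left_cancel₀ (mt S.φ_eq_zero.1 ha) h
  obtain ⟨z, rfl⟩ := S.exists_of_fixed x h.symm
  exact ⟨z, S.injective (by rw [hx, map_mul])⟩

theorem φ_dvd {c t n : GaussianInt} {y : O} (hc : c ≠ 0) (ht : S.φ (c * t) = y + S.σ y)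
    (hn : S.φ (c ^ 2 * n) = y * S.σ y) : S.φ c ∣ y := by
  have hc0 : algebraMap O (FractionRing O) (S.φ c) ≠ 0 := by
    simpa [S.φ_eq_zero] using hc
  have hint : IsIntegral O (algebraMap O (FractionRing O) y / algebraMap O (FractionRing O) (S.φ c)) := by
    refine ⟨Polynomial.X ^ 2 + (-Polynomial.C (S.φ t) * Polynomial.X + Polynomial.C (S.φ n)),
      ?_, ?_⟩
    · refine Polynomial.monic_X_pow_add ?_
      compute_degree!
    · simp only [Polynomial.eval₂_add, Polynomial.eval₂_mul, Polynomial.eval₂_neg,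
        Polynomial.eval₂_pow, Polynomial.eval₂_X, Polynomial.eval₂_C]
      have ht' := congrArg (algebraMap O (FractionRing O)) ht
      have hn' := congrArg (algebraMap O (FractionRing O)) hn
      simp only [map_mul, map_add, map_pow] at ht' hn'
      field_simp
      linear_combination (-algebraMap O (FractionRing O) y) * ht' + hn'
  obtain ⟨z, hz⟩ := IsIntegrallyClosed.algebraMap_eq_of_integral hint
  refine ⟨z, IsFractionRing.injective O (FractionRing O) ?_⟩
  rw [map_mul, hz]
  field_simp

theorem exists_mul_map_eq (I : Ideal O) :
    ∃ c : GaussianInt, I * I.map S.σ = Ideal.span {S.φ c} := by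
  let C : Ideal GaussianInt := Ideal.span {n | ∃ α ∈ I, S.φ n = α * S.σ α}
  obtain ⟨c, hc⟩ : ∃ c, C = Ideal.span {c} := (Submodule.isPrincipal_iff _).1 inferInstance
  have hdvd : ∀ α ∈ I, ∀ n, S.φ n = α * S.σ α → c ∣ n := by
    intro α hα n hn
    rw [← Ideal.mem_span_singleton, ← hc]
    exact Ideal.subset_span ⟨α, hα, hn⟩
  refine ⟨c, le_antisymm ?_ ?_⟩
  · rw [Ideal.mul_le]
    intro α hα β' hβ'
    obtain ⟨β, hβ, rfl⟩ := (Ideal.mem_map_of_equiv S.σ _).1 hβ'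
    rw [Ideal.mem_span_singleton]
    obtain ⟨n₁, hn₁⟩ := S.exists_norm α
    obtain ⟨n₂, hn₂⟩ := S.exists_norm β
    obtain ⟨n₃, hn₃⟩ := S.exists_norm (α + β)
    obtain ⟨m₁, rfl⟩ := hdvd α hα _ hn₁
    obtain ⟨m₂, rfl⟩ := hdvd β hβ _ hn₂
    obtain ⟨m₃, rfl⟩ := hdvd _ (add_mem hα hβ) _ hn₃
    rcases eq_or_ne c 0 with rfl | hc0
    · have h1 : α * S.σ α = 0 := by rw [← hn₁]; simp
      rcases mul_eq_zero.1 h1 with rfl | h1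
      · simp
      · rw [(map_eq_zero_iff S.σ S.σ.injective).1 h1]
        simp
    · refine S.φ_dvd (t := m₃ - m₁ - m₂) (n := m₁ * m₂) hc0 ?_ ?_
      · rw [map_add] at hn₃
        rw [mul_sub, mul_sub, map_sub, map_sub, hn₁, hn₂, hn₃, map_mul, S.invol]
        ring
      · rw [show c ^ 2 * (m₁ * m₂) = (c * m₁) * (c * m₂) by ring, map_mul, hn₁, hn₂, map_mul,
          S.invol]
        ring
  · rw [Ideal.span_singleton_le_iff_mem]
    have : C ≤ (I * I.map S.σ).comap S.φ := by
      rw [Ideal.span_le]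
      rintro n ⟨α, hα, hn⟩
      rw [SetLike.mem_coe, Ideal.mem_comap, hn]
      exact Ideal.mul_mem_mul hα (Ideal.mem_map_of_mem _ hα)
    exact this (hc ▸ Ideal.mem_span_singleton_self c)

open ClassGroup

theorem sq_ne_ofIdeal (hσδ : S.σ δ = -δ) (hδ : δ ^ 2 = S.φ d) {n : GaussianInt} (hn0 : n ≠ 0)
    (hn : ∀ u : GaussianInt, IsUnit u → GaussianInt.IsNormFree d (n * u)) {R : Ideal O}
    (hR : R ^ 2 = Ideal.span {S.φ n}) (x : ClassGroup O) : x ^ 2 ≠ ofIdeal R := by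
  intro hx
  have hR0 : R ≠ ⊥ := by
    rintro rfl
    rw [← Ideal.zero_eq_bot, zero_pow two_ne_zero, eq_comm, Ideal.zero_eq_bot,
      Ideal.span_singleton_eq_bot, S.φ_eq_zero] at hR
    exact hn0 hR
  obtain ⟨J, hJ0, hJ⟩ := exists_ofIdeal_eq x⁻¹
  have hJJ : J ^ 2 ≠ ⊥ := pow_ne_zero 2 hJ0
  have h1 : ofIdeal (R * J ^ 2) = 1 := by
    rw [ofIdeal_mul hR0 hJJ, pow_two, ofIdeal_mul hJ0 hJ0, hJ, ← hx]
    group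
  obtain ⟨α, hα⟩ := ofIdeal_eq_one_iff.1 h1
  obtain ⟨c, hc⟩ := S.exists_mul_map_eq J
  have hRσ : R.map S.σ = R := Ideal.sq_injective (by
    rw [← Ideal.map_pow, hR, S.map_span_φ])
  have hc0 : c ≠ 0 := by
    rintro rfl
    have := mul_ne_zero hJ0 (S.map_σ_ne_bot hJ0)
    exact this (by rw [hc]; simp)
  have h2 : Ideal.span {α * S.σ α} = Ideal.span {S.φ (n * c ^ 2)} := by
    have h3 : (Ideal.span {α}).map S.σ = Ideal.span {S.σ α} := by
      rw [Ideal.map_span, Set.image_singleton]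
    rw [← Ideal.span_singleton_mul_span_singleton, ← h3, ← hα, Ideal.map_mul, Ideal.map_pow, hRσ,
      map_mul, map_pow, ← Ideal.span_singleton_mul_span_singleton, ← Ideal.span_singleton_pow,
      ← hc, ← hR]
    ring
  obtain ⟨m, hm⟩ := S.exists_norm α
  rw [← hm] at h2
  have h3 : Associated m (n * c ^ 2) :=
    associated_of_dvd_dvd
      (S.φ_dvd_φ.1 (Ideal.span_singleton_le_span_singleton.1 h2.ge))
      (S.φ_dvd_φ.1 (Ideal.span_singleton_le_span_singleton.1 h2.le))
  obtain ⟨u, hu⟩ := h3.symm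
  refine hc0 (S.eq_zero_of_isNormFree hσδ hδ (hn u u.isUnit) (α := α) ?_)
  rw [← hm, ← hu]
  congr 1
  ring

end GaussianInvolution

end IdealClasses

section AmbiguousClasses

open ClassGroup

theorem GaussianInt.sq_eq_one_or_neg_one {u : GaussianInt} (hu : IsUnit u) :
    u ^ 2 = 1 ∨ u ^ 2 = -1 := by
  have h := Zsqrtd.norm_eq_one_iff.2 hu
  obtain ⟨a, b⟩ := u
  simp only [Zsqrtd.norm_def] at h
  have h1 : a * a + b * b = 1 := by
    have : 0 ≤ a * a + b * b := add_nonneg (mul_self_nonneg a) (mul_self_nonneg b)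
    have e : a * a - -1 * b * b = a * a + b * b := by ring
    rw [e] at h
    omega
  have ha : a ^ 2 ≤ 1 := by nlinarith [mul_self_nonneg b]
  have hb : b ^ 2 ≤ 1 := by nlinarith [mul_self_nonneg a]
  have ha' : a ≤ 1 := by nlinarith
  have ha'' : -1 ≤ a := by nlinarith
  have hb' : b ≤ 1 := by nlinarith
  have hb'' : -1 ≤ b := by nlinarith
  interval_cases a <;> interval_cases b <;> simp_all <;> decide

namespace GaussianInvolution

variable {O : Type*} [CommRing O] [IsDedekindDomain O] (S : GaussianInvolution O)
  {δ : O} {d : GaussianInt}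

theorem exists_map_eq (hσδ : S.σ δ = -δ) (hδ : δ ^ 2 = S.φ d)
    (hi : ∀ u : GaussianInt, u ^ 2 = -1 → GaussianInt.IsNormFree d u) {I : Ideal O} (hI : I ≠ ⊥)
    (h : ofIdeal I ^ 2 = 1) : ∃ J, J ≠ ⊥ ∧ ofIdeal J = ofIdeal I ∧ J.map S.σ = J := by
  obtain ⟨c, hc⟩ := S.exists_mul_map_eq I
  have hmap : ∀ x : O, (Ideal.span {x}).map S.σ = Ideal.span {S.σ x} := fun x => by
    rw [Ideal.map_span, Set.image_singleton]
  have hc0 : c ≠ 0 := by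
    rintro rfl
    exact mul_ne_zero hI (S.map_σ_ne_bot hI) (by rw [hc]; simp)
  obtain ⟨α, hα, hn⟩ : ∃ α, I ^ 2 = Ideal.span {α} ∧ α * S.σ α = S.φ c ^ 2 := by
    rw [pow_two, ← ofIdeal_mul hI hI, ofIdeal_eq_one_iff] at h
    obtain ⟨α, hα⟩ := h
    obtain ⟨m, hm⟩ := S.exists_norm α
    have h2 : Ideal.span {S.φ m} = Ideal.span {S.φ (c ^ 2)} := by
      rw [hm, map_pow, ← Ideal.span_singleton_mul_span_singleton, ← Ideal.span_singleton_pow, ← hc,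
        ← hmap, ← hα, Ideal.map_mul]
      ring
    obtain ⟨u, hu⟩ : Associated (c ^ 2) m := associated_of_dvd_dvd
      (S.φ_dvd_φ.1 (Ideal.span_singleton_le_span_singleton.1 h2.le))
      (S.φ_dvd_φ.1 (Ideal.span_singleton_le_span_singleton.1 h2.ge))
    rcases GaussianInt.sq_eq_one_or_neg_one u.isUnit with hu2 | hu2
    · rcases sq_eq_sq_iff_eq_or_eq_neg.1 (hu2.trans (one_pow 2).symm) with hu1 | hu1
      · exact ⟨α, by rw [pow_two, hα], by rw [← hm, ← hu, hu1, mul_one, map_pow]⟩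
      · have hj : (⟨0, 1⟩ : GaussianInt) * ⟨0, 1⟩ = -1 := by decide
        have hju : IsUnit (S.φ ⟨0, 1⟩) := by
          refine (IsUnit.of_mul_eq_one (-⟨0, 1⟩ : GaussianInt) ?_).map S.φ
          rw [mul_neg, hj, neg_neg]
        refine ⟨S.φ ⟨0, 1⟩ * α, ?_, ?_⟩
        · rw [pow_two, hα, Ideal.span_singleton_mul_left_unit hju]
        · rw [map_mul, S.map_φ, mul_mul_mul_comm, ← hm, ← map_mul, ← map_mul, hj, ← hu, hu1,
            ← map_pow]
          congr 1
          ring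
    · exact absurd (S.eq_zero_of_isNormFree hσδ hδ (hi u hu2) (c := c) (α := α)
        (by rw [← hm, ← hu, mul_comm])) hc0
  have hβ : α * S.σ (α + S.φ c) = S.φ c * (α + S.φ c) := by
    rw [map_add, S.map_φ]
    linear_combination hn
  have hmul : I * Ideal.span {S.σ (α + S.φ c)} = I.map S.σ * Ideal.span {α + S.φ c} := by
    have := congrArg (fun x => Ideal.span {x}) hβ
    simp only [← Ideal.span_singleton_mul_span_singleton, ← hc, ← hα] at this
    refine mul_left_cancel₀ hI ?_
    rw [← mul_assoc, ← mul_assoc, ← pow_two, this]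
  by_cases h0 : α + S.φ c = 0
  · refine ⟨I, hI, rfl, ?_⟩
    refine (mul_left_cancel₀ hI ?_).symm
    rw [hc, ← pow_two, hα, eq_neg_of_add_eq_zero_left h0, Ideal.span_singleton_neg]
  · have h0' : Ideal.span {S.σ (α + S.φ c)} ≠ ⊥ := by
      rw [Ne, Ideal.span_singleton_eq_bot, map_eq_zero_iff S.σ S.σ.injective]
      exact h0
    refine ⟨I * Ideal.span {S.σ (α + S.φ c)}, mul_ne_zero hI h0', ?_, ?_⟩
    · rw [ofIdeal_mul hI h0', ofIdeal_span_singleton, mul_one]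
    · rw [Ideal.map_mul, hmap, S.invol, hmul]

theorem ofIdeal_mem (hσδ : S.σ δ = -δ) (hδ : δ ^ 2 = S.φ d) (H : Subgroup (ClassGroup O))
    (hH : ∀ ρ : GaussianInt, Prime ρ → ρ ∣ 2 * d →
      ∃ R : Ideal O, R ^ 2 = Ideal.span {S.φ ρ} ∧ ofIdeal R ∈ H)
    {b : GaussianInt} {J : Ideal O} (hJ0 : J ≠ ⊥) (hJ : J ^ 2 = Ideal.span {S.φ b}) :
    ofIdeal J ∈ H := by
  induction b using (wellFounded_dvdNotUnit (α := GaussianInt)).induction generalizing J with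
  | _ b ih =>
  have hb0 : b ≠ 0 := by
    rintro rfl
    exact pow_ne_zero 2 hJ0 (by rw [hJ]; simp)
  have step : ∀ (R : Ideal O) (r : GaussianInt), R ^ 2 = Ideal.span {S.φ r} → ofIdeal R ∈ H →
      ¬ IsUnit r → r ∣ b → ofIdeal J ∈ H := by
    rintro R r hR hRH hr ⟨b', rfl⟩
    obtain ⟨J', rfl⟩ : R ∣ J := by
      rw [← UniqueFactorizationMonoid.pow_dvd_pow_iff_dvd two_ne_zero, hJ, hR, map_mul,
        ← Ideal.span_singleton_mul_span_singleton]
      exact dvd_mul_right _ _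
    have hR0 : R ≠ ⊥ := left_ne_zero_of_mul hJ0
    have hJ'0 : J' ≠ ⊥ := right_ne_zero_of_mul hJ0
    rw [ofIdeal_mul hR0 hJ'0]
    refine H.mul_mem hRH (ih b' ⟨right_ne_zero_of_mul hb0, r, hr, mul_comm _ _⟩ hJ'0 ?_)
    refine mul_left_cancel₀ (pow_ne_zero 2 hR0) ?_
    rw [← mul_pow, hJ, hR, map_mul, Ideal.span_singleton_mul_span_singleton]
  by_cases hbu : IsUnit b
  · have hJ1 : J = ⊤ := by
      have h1 := Ideal.span_singleton_eq_top.2 (hbu.map S.φ)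
      rw [← hJ] at h1
      exact Ideal.sq_injective (by rw [h1, ← Ideal.one_eq_top, one_pow])
    rw [hJ1, ← Ideal.span_singleton_one, ofIdeal_span_singleton]
    exact H.one_mem
  obtain ⟨ρ, hρi, hρb⟩ := WfDvdMonoid.exists_irreducible_factor hbu hb0
  have hρ : Prime ρ := hρi.prime
  by_cases hρd : ρ ∣ 2 * d
  · obtain ⟨R, hR, hRH⟩ := hH ρ hρ hρd
    exact step R ρ hR hRH hρ.not_isUnit hρb
  refine step (Ideal.span {S.φ ρ}) (ρ ^ 2) (by rw [Ideal.span_singleton_pow, map_pow])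
    (by rw [ofIdeal_span_singleton]; exact H.one_mem)
    (fun h => hρ.not_isUnit ((isUnit_pow_iff two_ne_zero).1 h)) ?_
  have hJσ : J.map S.σ = J := Ideal.sq_injective (by
    rw [← Ideal.map_pow, hJ, S.map_span_φ])
  have htr : ∀ x ∈ J, ∀ t, S.φ t = x + S.σ x → ρ ∣ t := by
    intro x hx t ht
    have htJ : S.φ t ∈ J := by
      rw [ht]
      exact add_mem hx (hJσ ▸ Ideal.mem_map_of_mem _ hx)
    have := Ideal.pow_mem_pow htJ 2
    rw [hJ, Ideal.mem_span_singleton, ← map_pow, S.φ_dvd_φ] at this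
    exact hρ.dvd_of_dvd_pow (hρb.trans this)
  have hle : Ideal.span {2 * δ} * J ≤ Ideal.span {S.φ ρ} := by
    rw [Ideal.span_singleton_mul_le_iff]
    intro x hx
    obtain ⟨t, ht⟩ := S.exists_trace x
    obtain ⟨s, hs⟩ := S.exists_trace (δ * x)
    have h1 := map_dvd S.φ (htr x hx t ht)
    have h2 := map_dvd S.φ (htr _ (J.mul_mem_left δ hx) s hs)
    rw [Ideal.mem_span_singleton, show 2 * δ * x = δ * S.φ t + S.φ s by
      rw [ht, hs, map_mul, hσδ]; ring]
    exact dvd_add (h1.mul_left _) h2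
  have hle2 := Ideal.pow_right_mono hle 2
  rw [mul_pow, hJ, Ideal.span_singleton_pow, Ideal.span_singleton_pow,
    Ideal.span_singleton_mul_span_singleton, Ideal.span_singleton_le_span_singleton, mul_pow, hδ,
    ← map_ofNat S.φ 2, ← map_pow, ← map_pow, ← map_mul, ← map_mul, S.φ_dvd_φ] at hle2
  refine hρ.pow_dvd_of_dvd_mul_left 2 (fun h => hρd ?_) hle2
  rcases hρ.dvd_or_dvd h with h | h
  · exact (hρ.dvd_of_dvd_pow h).mul_right _
  · exact h.mul_left _

end GaussianInvolution

end AmbiguousClasses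

section NonSquares

open GaussianInt

theorem GaussianInt.norm_eq_one_of_isUnit {u : GaussianInt} (hu : IsUnit u) : u.norm = 1 :=
  (Zsqrtd.norm_eq_one_iff' (by norm_num) u).2 hu

theorem GaussianInt.norm_eq_of_mul_star_eq {π : GaussianInt} {p : ℕ} (h : π * star π = p) :
    π.norm = p := by
  rw [← Zsqrtd.norm_eq_mul_conj] at h
  exact_mod_cast h

theorem GaussianInt.prime_of_norm_eq {z : GaussianInt} {n : ℕ} (hn : n.Prime) (h : z.norm = n) :
    Prime z := by
  refine Irreducible.prime ⟨fun hu => ?_, fun a b hab => ?_⟩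
  · rw [norm_eq_one_of_isUnit hu] at h
    exact hn.one_lt.ne (by exact_mod_cast h)
  · have h1 : a.norm.natAbs * b.norm.natAbs = n := by
      rw [← Int.natAbs_mul, ← Zsqrtd.norm_mul, ← hab, h, Int.natAbs_natCast]
    rw [← h1, Nat.prime_mul_iff] at hn
    rcases hn with ⟨-, hn⟩ | ⟨-, hn⟩
    · exact Or.inr (Zsqrtd.norm_eq_one_iff.1 hn)
    · exact Or.inl (Zsqrtd.norm_eq_one_iff.1 hn)

theorem GaussianInt.norm_one_add_I : (⟨1, 1⟩ : GaussianInt).norm = 2 := by decide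

variable {p q : ℕ} [Fact p.Prime] [Fact q.Prime]

theorem legendreSym.two_eq_neg_one {p : ℕ} [Fact p.Prime] (hp : p % 8 = 3 ∨ p % 8 = 5) :
    legendreSym p 2 = -1 := by
  rw [legendreSym.at_two (by omega), ZMod.χ₈_nat_eq_if_mod_eight, if_neg (by omega),
    if_neg (by omega)]

theorem legendreSym.eq_one_or_neg_one_of_mod (hp : p % 8 = 5) (hq : q % 8 = 3) :
    legendreSym q p = 1 ∨ legendreSym q p = -1 := by
  refine legendreSym.eq_one_or_neg_one q fun h => ?_
  have := (Nat.prime_dvd_prime_iff_eq Fact.out Fact.out).1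
    ((ZMod.natCast_eq_zero_iff p q).1 (by exact_mod_cast h))
  omega

theorem GaussianInt.isNormFree_one_add_I_mul (hp : p % 8 = 5) (hq : q % 8 = 3) {u : GaussianInt}
    (hu : IsUnit u) : IsNormFree (2 * p * q) (⟨1, 1⟩ * u) := by
  refine isNormFree_of_legendreSym hp hq ?_
  rw [Zsqrtd.norm_mul, norm_eq_one_of_isUnit hu, norm_one_add_I, mul_one,
    legendreSym.two_eq_neg_one (Or.inl hq)]

variable {π : GaussianInt} {ψ : GaussianInt →+* ZMod p}

theorem GaussianInt.isNormFree_mul_unit (hp : p % 8 = 5) (hq : q % 8 = 3)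
    (hπ : π * star π = p) (hψ : ∀ z, ψ z = 0 ↔ π ∣ z) (hψ' : ψ (star π) ≠ 0) {u : GaussianInt}
    (hu : IsUnit u) : IsNormFree (2 * p * q) (π * u) := by
  rcases legendreSym.eq_one_or_neg_one_of_mod hp hq with h | h
  · refine isNormFree_mul hp hq hπ hψ hψ' ?_
    rw [legendreSym.quadratic_reciprocity_one_mod_four (by omega) (by omega)] at h
    rw [legendreSym] at h
    rw [norm_eq_one_of_isUnit hu, Int.cast_one, one_mul, ← Int.cast_natCast q, h]
  · refine isNormFree_of_legendreSym hp hq ?_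
    rw [Zsqrtd.norm_mul, norm_eq_one_of_isUnit hu, norm_eq_of_mul_star_eq hπ, mul_one, h]

theorem GaussianInt.isNormFree_one_add_I_mul_mul_unit (hp : p % 8 = 5) (hq : q % 8 = 3)
    (hπ : π * star π = p) (hψ : ∀ z, ψ z = 0 ↔ π ∣ z) (hψ' : ψ (star π) ≠ 0) {u : GaussianInt}
    (hu : IsUnit u) : IsNormFree (2 * p * q) (⟨1, 1⟩ * π * u) := by
  rcases legendreSym.eq_one_or_neg_one_of_mod hp hq with h | h
  · refine isNormFree_of_legendreSym hp hq ?_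
    rw [Zsqrtd.norm_mul, Zsqrtd.norm_mul, norm_eq_one_of_isUnit hu, norm_eq_of_mul_star_eq hπ,
      norm_one_add_I, mul_one, legendreSym.mul, h, legendreSym.two_eq_neg_one (Or.inl hq), mul_one]
  · rw [mul_comm _ π, mul_assoc π]
    refine isNormFree_mul hp hq hπ hψ hψ' ?_
    rw [legendreSym.quadratic_reciprocity_one_mod_four (by omega) (by omega)] at h
    have h2 := legendreSym.two_eq_neg_one (Or.inr hp)
    rw [legendreSym] at h h2
    rw [Zsqrtd.norm_mul, norm_eq_one_of_isUnit hu, norm_one_add_I, mul_one, map_mul, h2,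
      ← Int.cast_natCast q, h]
    rfl

end NonSquares

section ClassGroup

open ClassGroup GaussianInt

namespace GaussianInvolution

section CommRing

variable {O : Type*} [CommRing O] (S : GaussianInvolution O) {δ : O} {d : GaussianInt}

theorem exists_sq_eq_span (hδ : δ ^ 2 = S.φ d) {r w : GaussianInt} (hd : d = r * w)
    (h : IsCoprime r w) : ∃ R : Ideal O, R ^ 2 = Ideal.span {S.φ r} :=
  ⟨_, Ideal.span_pair_sq_of_isCoprime (by rw [hδ, hd, map_mul]) (h.map S.φ)⟩

theorem exists_sq_eq_span_one_add_I {η : O} {n : ℕ} (hn : n % 8 = 7)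
    (hη : η ^ 2 = S.φ (⟨0, -1⟩ * n)) :
    ∃ R : Ideal O, R ^ 2 = Ideal.span {S.φ ⟨1, 1⟩} := by
  obtain ⟨k, rfl⟩ : ∃ k, n = 8 * k + 7 := ⟨n / 8, by omega⟩
  have h1 : (1 : GaussianInt) + ⟨0, -1⟩ * ((8 * k + 7 : ℕ) : GaussianInt) =
      ⟨1, 1⟩ * (1 - 4 * (k + 1) * ⟨1, 1⟩) := by
    apply Zsqrtd.ext
    · simp
    · simp
      ring
  have h2 : (2 : GaussianInt) = ⟨1, 1⟩ * (⟨1, 1⟩ * ⟨0, -1⟩) := by decide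
  have h1' := congrArg S.φ h1
  have h2' := congrArg S.φ h2
  simp only [map_add, map_one, map_mul, map_sub, map_ofNat, map_natCast] at h1' h2' hη
  refine ⟨_, Ideal.span_pair_sq_of_isCoprime (y := 1 + η)
    (w := 1 + S.φ ⟨1, 1⟩ * (-4 * (k + 1) + S.φ ⟨0, -1⟩ * η)) ?_
    ⟨-(-4 * (k + 1) + S.φ ⟨0, -1⟩ * η), 1, by ring⟩⟩
  linear_combination hη + h1' + η * h2'

theorem span_sq_of_pell {r s : GaussianInt} (hδ : δ ^ 2 = S.φ (r * s)) {t v : GaussianInt}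
    (h : (r * t ^ 2 - s * v ^ 2) ^ 2 = 1) :
    Ideal.span {S.φ (r * t) + δ * S.φ v} ^ 2 = Ideal.span {S.φ r} := by
  have h' := congrArg S.φ h
  simp only [map_mul, map_sub, map_pow, map_one] at h' hδ
  have hu : IsUnit (S.φ (r * t ^ 2 + s * v ^ 2) + S.φ (2 * t * v) * δ) := by
    refine IsUnit.of_mul_eq_one (S.φ (r * t ^ 2 + s * v ^ 2) - S.φ (2 * t * v) * δ) ?_
    simp only [map_mul, map_add, map_pow, map_ofNat]
    linear_combination h' - 4 * S.φ t ^ 2 * S.φ v ^ 2 * hδ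
  rw [Ideal.span_singleton_pow, ← Ideal.span_singleton_mul_left_unit hu (S.φ r)]
  congr 2
  simp only [map_mul, map_add, map_pow, map_ofNat]
  linear_combination S.φ v ^ 2 * hδ

end CommRing

variable {O : Type*} [CommRing O] [IsDedekindDomain O] (S : GaussianInvolution O)
  {δ : O} {d : GaussianInt}

theorem exists_one_add_I_mul_eq (hσδ : S.σ δ = -δ) (hδ : δ ^ 2 = S.φ (2 * d)) :
    ∃ η, S.φ ⟨1, 1⟩ * η = δ ∧ η ^ 2 = S.φ (⟨0, -1⟩ * d) := by
  have h0 : (⟨1, 1⟩ : GaussianInt) ≠ 0 := by decide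
  have h2 : (2 : GaussianInt) = ⟨1, 1⟩ ^ 2 * ⟨0, -1⟩ := by decide
  have h3 : (⟨0, 1⟩ : GaussianInt) = -⟨0, -1⟩ := by decide
  obtain ⟨η, hη⟩ := S.φ_dvd (t := 0) (n := ⟨0, 1⟩ * d) (y := δ) h0 (by simp [hσδ]) (by
    rw [hσδ, mul_neg, ← pow_two, hδ, ← map_neg, h2, h3]
    congr 1
    ring)
  refine ⟨η, hη.symm, mul_left_cancel₀ (pow_ne_zero 2 (mt S.φ_eq_zero.1 h0)) ?_⟩
  rw [← mul_pow, ← hη, hδ, ← map_pow, ← map_mul, h2, mul_assoc]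

theorem ofIdeal_sq_eq_one {R : Ideal O} {x : O} (hx : x ≠ 0) (hR : R ^ 2 = Ideal.span {x}) :
    ofIdeal R ^ 2 = 1 := by
  have hR0 : R ≠ ⊥ := by
    rintro rfl
    rw [← Ideal.zero_eq_bot, zero_pow two_ne_zero, eq_comm, Ideal.zero_eq_bot,
      Ideal.span_singleton_eq_bot] at hR
    exact hx hR
  rw [pow_two, ← ofIdeal_mul hR0 hR0, ← pow_two, hR, ofIdeal_span_singleton]

theorem ofIdeal_eq_one {r : O} {R : Ideal O} (hR : R ^ 2 = Ideal.span {r})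
    {x : O} (hx : Ideal.span {x} ^ 2 = Ideal.span {r}) : ofIdeal R = 1 :=
  ofIdeal_eq_one_iff.2 ⟨x, Ideal.sq_injective (hR.trans hx.symm)⟩

theorem ofIdeal_eq_one_of_mul {r s η x : O} {R : Ideal O} (hr : r ≠ 0) (hs : s ≠ 0)
    (hR : R ^ 2 = Ideal.span {r}) (hx : Ideal.span {x} ^ 2 = Ideal.span {s})
    (hη : Ideal.span {η} ^ 2 = Ideal.span {r * s}) : ofIdeal R = 1 := by
  have h : R * Ideal.span {x} = Ideal.span {η} := Ideal.sq_injective (by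
    rw [mul_pow, hR, hx, hη, Ideal.span_singleton_mul_span_singleton])
  have h0 : (Ideal.span {η} : Ideal O) ≠ ⊥ := by
    intro h0
    rw [h0, ← Ideal.zero_eq_bot, zero_pow two_ne_zero, eq_comm, Ideal.zero_eq_bot,
      Ideal.span_singleton_eq_bot] at hη
    exact mul_ne_zero hr hs hη
  rw [← h] at h0
  have h1 := ofIdeal_mul (left_ne_zero_of_mul h0) (right_ne_zero_of_mul h0)
  rwa [h, ofIdeal_span_singleton, ofIdeal_span_singleton, mul_one, eq_comm] at h1

end GaussianInvolution

end ClassGroup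

section ClassGroupTypeTwoTwo

open ClassGroup GaussianInt

theorem Subgroup.mem_closure_pair_of_sq_eq_one {G : Type*} [CommGroup G] {a b x : G}
    (ha : a ^ 2 = 1) (hb : b ^ 2 = 1) (hx : x ∈ Subgroup.closure {a, b}) :
    x = 1 ∨ x = a ∨ x = b ∨ x = a * b := by
  have key : ∀ {g : G}, g ^ 2 = 1 → ∀ m : ℤ, g ^ m = 1 ∨ g ^ m = g := by
    intro g hg m
    have hg' : g ^ (2 : ℤ) = 1 := by exact_mod_cast hg
    rcases Int.even_or_odd' m with ⟨k, rfl | rfl⟩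
    · exact Or.inl (by rw [zpow_mul, hg', one_zpow])
    · exact Or.inr (by rw [zpow_add, zpow_mul, hg', one_zpow, one_mul, zpow_one])
  obtain ⟨m, n, rfl⟩ := Subgroup.mem_closure_pair.1 hx
  rcases key ha m with h | h <;> rcases key hb n with h' | h' <;> simp [h, h']

namespace GaussianInvolution

variable {O : Type*} [CommRing O] [IsDedekindDomain O] (S : GaussianInvolution O) {δ : O}
  {p q : ℕ} [Fact p.Prime] [Fact q.Prime]

theorem ofIdeal_eq_one_of_sq_eq_prime (hp : p % 8 = 5) (hq : q % 8 = 3) (hσδ : S.σ δ = -δ)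
    (hδ : δ ^ 2 = S.φ (2 * p * q)) :
    (∀ R : Ideal O, R ^ 2 = Ideal.span {S.φ p} → ofIdeal R = 1) ∧
      ∀ R : Ideal O, R ^ 2 = Ideal.span {S.φ q} → ofIdeal R = 1 := by
  have hp0 : S.φ p ≠ 0 := by
    rw [Ne, S.φ_eq_zero]
    exact_mod_cast (Fact.out : p.Prime).ne_zero
  have hq0 : S.φ q ≠ 0 := by
    rw [Ne, S.φ_eq_zero]
    exact_mod_cast (Fact.out : q.Prime).ne_zero
  obtain ⟨η, -, hη⟩ := S.exists_one_add_I_mul_eq (d := p * q) hσδ (by rw [hδ, mul_assoc])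
  have hη' : Ideal.span {η} ^ 2 = Ideal.span {S.φ p * S.φ q} := by
    have hu : IsUnit (S.φ ⟨0, -1⟩) :=
      (IsUnit.of_mul_eq_one (⟨0, 1⟩ : GaussianInt) (by decide)).map S.φ
    rw [Ideal.span_singleton_pow, hη, map_mul, Ideal.span_singleton_mul_left_unit hu, map_mul]
  obtain ⟨t, s, h | h⟩ := Pell.exists_sq_eq_one_of_mod_eight hp hq
  · have hx := S.span_sq_of_pell (δ := δ) (r := p) (s := 2 * q) (t := t) (v := s)
      (by rw [hδ]; congr 1; ring) (by exact_mod_cast congrArg (Int.cast : ℤ → GaussianInt) h)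
    exact ⟨fun R hR => ofIdeal_eq_one hR hx, fun R hR =>
      ofIdeal_eq_one_of_mul hq0 hp0 hR hx (by rw [hη', mul_comm])⟩
  · have hx := S.span_sq_of_pell (δ := δ) (r := q) (s := 2 * p) (t := t) (v := s)
      (by rw [hδ]; congr 1; ring) (by exact_mod_cast congrArg (Int.cast : ℤ → GaussianInt) h)
    exact ⟨fun R hR => ofIdeal_eq_one_of_mul hp0 hq0 hR hx hη', fun R hR => ofIdeal_eq_one hR hx⟩

theorem nonempty_mulEquiv_zmod_two_prod [Finite (ClassGroup O)] (hp : p % 8 = 5)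
    (hq : q % 8 = 3) (hσδ : S.σ δ = -δ) (hδ : δ ^ 2 = S.φ (2 * p * q))
    (P : Sylow 2 (ClassGroup O)) : Nonempty (P ≃* Multiplicative (ZMod 2 × ZMod 2)) := by
  have hpP : p.Prime := Fact.out
  have hqP : q.Prime := Fact.out
  obtain ⟨π, ψ, hπ, hψ, hψ'⟩ := exists_ringHom_zmod (p := p) (by omega)
  have hnπ := norm_eq_of_mul_star_eq hπ
  have hπP : Prime π := prime_of_norm_eq hpP hnπ
  have hπP' : Prime (star π) := prime_of_norm_eq hpP (by rw [Zsqrtd.norm_conj, hnπ])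
  have hqPi : Prime (q : GaussianInt) := prime_of_nat_prime_of_mod_four_eq_three q (by omega)
  have hlP : Prime (⟨1, 1⟩ : GaussianInt) := prime_of_norm_eq Nat.prime_two norm_one_add_I
  have hφ0 : ∀ {z : GaussianInt}, Prime z → S.φ z ≠ 0 := fun hz => mt S.φ_eq_zero.1 hz.ne_zero
  have hcop : IsCoprime π (2 * star π * q) := by
    rw [hπP.irreducible.coprime_iff_not_dvd, ← hψ, map_mul, map_mul, map_ofNat, map_natCast]
    exact mul_ne_zero (mul_ne_zero (map_two_ne_zero hp) hψ') (natCast_ne_zero_of_mod hp hq)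
  have hcop' : IsCoprime (star π) (2 * π * q) := by
    have := hcop.map (starRingEnd GaussianInt)
    rwa [map_mul, map_mul, map_ofNat, map_natCast, starRingEnd_apply, starRingEnd_apply,
      star_star] at this
  have hcopq : IsCoprime (q : GaussianInt) (2 * p) := by
    have h1 : IsCoprime (q : ℤ) (2 * p : ℕ) := by
      rw [Nat.isCoprime_iff_coprime, hqP.coprime_iff_not_dvd, hqP.dvd_mul,
        Nat.prime_dvd_prime_iff_eq hqP Nat.prime_two, Nat.prime_dvd_prime_iff_eq hqP hpP]
      omega
    simpa using h1.map (Int.castRingHom GaussianInt)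
  obtain ⟨R, hR⟩ : ∃ R : Ideal O, R ^ 2 = Ideal.span {S.φ π} :=
    S.exists_sq_eq_span hδ (w := 2 * star π * q) (by rw [← hπ]; ring) hcop
  obtain ⟨R', hR'⟩ : ∃ R : Ideal O, R ^ 2 = Ideal.span {S.φ (star π)} :=
    S.exists_sq_eq_span hδ (w := 2 * π * q) (by rw [← hπ]; ring) hcop'
  obtain ⟨Q, hQ⟩ : ∃ R : Ideal O, R ^ 2 = Ideal.span {S.φ q} :=
    S.exists_sq_eq_span hδ (w := 2 * p) (by ring) hcopq
  obtain ⟨L, hL⟩ : ∃ R : Ideal O, R ^ 2 = Ideal.span {S.φ ⟨1, 1⟩} := by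
    obtain ⟨η, -, hη⟩ := S.exists_one_add_I_mul_eq (d := p * q) hσδ (by rw [hδ, mul_assoc])
    refine S.exists_sq_eq_span_one_add_I (η := η) (n := p * q) ?_ (by rw [hη, Nat.cast_mul])
    rw [Nat.mul_mod, hp, hq]
  have hne : ∀ {I : Ideal O} {z : GaussianInt}, Prime z → I ^ 2 = Ideal.span {S.φ z} → I ≠ ⊥ := by
    rintro I z hz hI rfl
    rw [← Ideal.zero_eq_bot, zero_pow two_ne_zero, eq_comm, Ideal.zero_eq_bot,
      Ideal.span_singleton_eq_bot] at hI
    exact hφ0 hz hI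
  have hLR : (L * R) ^ 2 = Ideal.span {S.φ (⟨1, 1⟩ * π)} := by
    rw [mul_pow, hL, hR, map_mul, Ideal.span_singleton_mul_span_singleton]
  have hRR : (R * R') ^ 2 = Ideal.span {S.φ p} := by
    rw [mul_pow, hR, hR', ← hπ, map_mul, Ideal.span_singleton_mul_span_singleton]
  obtain ⟨hp1, hq1⟩ := S.ofIdeal_eq_one_of_sq_eq_prime hp hq hσδ hδ
  have ha := ofIdeal_sq_eq_one (hφ0 hlP) hL
  have hb := ofIdeal_sq_eq_one (hφ0 hπP) hR
  have hab := ofIdeal_mul (hne hlP hL) (hne hπP hR)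
  have hRR1 := hp1 _ hRR
  rw [ofIdeal_mul (hne hπP hR) (hne hπP' hR')] at hRR1
  refine Sylow.nonempty_mulEquiv_zmod_two_prod ha hb
    (S.sq_ne_ofIdeal hσδ hδ hlP.ne_zero (fun u hu => isNormFree_one_add_I_mul hp hq hu) hL)
    (S.sq_ne_ofIdeal hσδ hδ hπP.ne_zero (fun u hu => isNormFree_mul_unit hp hq hπ hψ hψ' hu) hR)
    (hab ▸ S.sq_ne_ofIdeal hσδ hδ (mul_ne_zero hlP.ne_zero hπP.ne_zero)
      (fun u hu => isNormFree_one_add_I_mul_mul_unit hp hq hπ hψ hψ' hu) hLR)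
    (fun x hx => Subgroup.mem_closure_pair_of_sq_eq_one ha hb ?_) P
  obtain ⟨I, hI0, rfl⟩ := exists_ofIdeal_eq x
  obtain ⟨J, hJ0, hJI, hJσ⟩ := S.exists_map_eq hσδ hδ (fun u hu =>
    isNormFree_of_not_isSquare hp hq hπ hψ hψ' (not_isSquare_map_of_sq hp hu)) hI0 hx
  obtain ⟨b, hb⟩ := S.exists_mul_map_eq J
  rw [hJσ, ← pow_two] at hb
  rw [← hJI]
  have haH : ofIdeal L ∈ Subgroup.closure {ofIdeal L, ofIdeal R} :=
    Subgroup.subset_closure (by simp)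
  have hbH : ofIdeal R ∈ Subgroup.closure {ofIdeal L, ofIdeal R} :=
    Subgroup.subset_closure (by simp)
  refine S.ofIdeal_mem hσδ hδ _ (fun ρ hρ hρd => ?_) hJ0 hb
  have key : ∀ (z : GaussianInt) (I : Ideal O), Prime z → I ^ 2 = Ideal.span {S.φ z} →
      ofIdeal I ∈ Subgroup.closure {ofIdeal L, ofIdeal R} → ρ ∣ z →
      ∃ R₁ : Ideal O, R₁ ^ 2 = Ideal.span {S.φ ρ} ∧
        ofIdeal R₁ ∈ Subgroup.closure {ofIdeal L, ofIdeal R} := by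
    intro z I hz hI hIH h
    refine ⟨I, ?_, hIH⟩
    rw [hI, Ideal.span_singleton_eq_span_singleton]
    exact (hρ.associated_of_dvd hz h).symm.map S.φ
  have h2 : (2 : GaussianInt) = ⟨1, 1⟩ * (⟨1, 1⟩ * ⟨0, -1⟩) := by decide
  have hu : IsUnit (⟨0, -1⟩ : GaussianInt) := IsUnit.of_mul_eq_one ⟨0, 1⟩ (by decide)
  have hdvd2 : ρ ∣ 2 → ρ ∣ ⟨1, 1⟩ := by
    rw [h2, hρ.dvd_mul, hρ.dvd_mul]
    rintro (h | h | h)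
    · exact h
    · exact h
    · exact absurd (isUnit_of_dvd_unit h hu) hρ.not_isUnit
  rw [← hπ, hρ.dvd_mul, hρ.dvd_mul, hρ.dvd_mul, hρ.dvd_mul] at hρd
  rcases hρd with h | (h | h | h) | h
  · exact key _ L hlP hL haH (hdvd2 h)
  · exact key _ L hlP hL haH (hdvd2 h)
  · exact key _ R hπP hR hbH h
  · refine key _ R' hπP' hR' ?_ h
    rw [← inv_eq_of_mul_eq_one_right hRR1]
    exact inv_mem hbH
  · refine key _ Q hqPi hQ ?_ h
    rw [hq1 Q hQ]
    exact one_mem _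

end GaussianInvolution

end ClassGroupTypeTwoTwo

section BiquadraticField

theorem GaussianInt.exists_rat_eq_of_isIntegral {a b : ℚ}
    (h₁ : ∃ n : ℤ, (n : ℚ) = 2 * a) (h₂ : ∃ n : ℤ, (n : ℚ) = a ^ 2 + b ^ 2) :
    (∃ m : ℤ, (m : ℚ) = a) ∧ ∃ m : ℤ, (m : ℚ) = b := by
  obtain ⟨A, hA⟩ := h₁
  obtain ⟨n, hn⟩ := h₂
  obtain ⟨B, hB⟩ : ∃ B : ℤ, (B : ℚ) = 2 * b := by
    have h : (2 * b) ^ 2 = ((4 * n - A ^ 2 : ℤ) : ℚ) := by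
      push_cast
      rw [hA, hn]
      ring
    have hint : IsIntegral ℤ (2 * b) := by
      refine IsIntegral.of_pow two_pos ?_
      rw [h]
      exact isIntegral_algebraMap
    exact IsIntegrallyClosed.algebraMap_eq_of_integral hint
  have hAB : A ^ 2 + B ^ 2 = 4 * n := by
    have : ((A ^ 2 + B ^ 2 : ℤ) : ℚ) = (4 * n : ℤ) := by
      push_cast
      rw [hA, hB, hn]
      ring
    exact_mod_cast this
  have key : A % 2 = 0 ∧ B % 2 = 0 := by
    have h4 : (A ^ 2 + B ^ 2) % 4 = 0 := by omega
    rcases Int.even_or_odd' A with ⟨k, rfl | rfl⟩ <;> rcases Int.even_or_odd' B with ⟨l, rfl | rfl⟩ <;>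
      ring_nf at h4 <;> omega
  refine ⟨⟨A / 2, ?_⟩, ⟨B / 2, ?_⟩⟩
  · obtain ⟨k, rfl⟩ := Int.dvd_of_emod_eq_zero key.1
    rw [Int.mul_ediv_cancel_left _ two_ne_zero]
    push_cast at hA
    linarith
  · obtain ⟨k, rfl⟩ := Int.dvd_of_emod_eq_zero key.2
    rw [Int.mul_ediv_cancel_left _ two_ne_zero]
    push_cast at hB
    linarith

/-- The ring homomorphism from a quadratic algebra that extends `g` and maps `ω` to `t`. -/
def QuadraticAlgebra.liftRingHom {R A : Type*} [CommRing R] [CommRing A] {a : R} (g : R →+* A)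
    (t : A) (ht : t * t = g a) : QuadraticAlgebra R a 0 →+* A where
  toFun z := g z.re + g z.im * t
  map_zero' := by simp
  map_one' := by simp
  map_add' x y := by
    simp only [QuadraticAlgebra.re_add, QuadraticAlgebra.im_add, map_add]
    ring
  map_mul' x y := by
    simp only [QuadraticAlgebra.re_mul, QuadraticAlgebra.im_mul, map_add, map_mul, map_zero]
    linear_combination (-g x.im * g y.im) * ht

/-- The field `ℚ(i)`, as a quadratic algebra. -/
abbrev GaussianRat : Type := QuadraticAlgebra ℚ (-1) 0

instance : Fact (∀ r : ℚ, r ^ 2 ≠ -1 + 0 * r) := ⟨fun r h => by nlinarith [sq_nonneg r]⟩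

/-- The embedding of `ℚ(i)` in a field that contains a square root of `-1`. -/
noncomputable def GaussianRat.lift {K : Type*} [Field K] [CharZero K] (i : K) (hi : i * i = -1) :
    GaussianRat →+* K :=
  QuadraticAlgebra.liftRingHom (algebraMap ℚ K) i (by simp [hi])

theorem GaussianInt.exists_eq_of_isIntegral {K : Type*} [Field K] [CharZero K] {i : K}
    (hi : i * i = -1) {a b : ℚ} (h : IsIntegral ℤ ((a : K) + b * i)) :
    ∃ m n : ℤ, (a : K) + b * i = m + n * i := by
  let z : GaussianRat := ⟨a, b⟩
  have hz : IsIntegral ℤ z :=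
    (isIntegral_algHom_iff (GaussianRat.lift i hi).toIntAlgHom (GaussianRat.lift i hi).injective).1 h
  have hz' : IsIntegral ℤ (star z) := hz.map (starRingEnd GaussianRat).toIntAlgHom
  have hC : ∀ r : ℚ, IsIntegral ℤ (⟨r, 0⟩ : GaussianRat) → ∃ n : ℤ, (n : ℚ) = r := fun r hr =>
    IsIntegrallyClosed.algebraMap_eq_of_integral ((isIntegral_algHom_iff
      (algebraMap ℚ GaussianRat).toIntAlgHom (algebraMap ℚ GaussianRat).injective).1 hr)
  have hadd : z + star z = ⟨2 * a, 0⟩ := by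
    ext
    · simp [z, two_mul]
    · simp [z]
  have hmul : z * star z = ⟨a ^ 2 + b ^ 2, 0⟩ := by
    ext
    · simp [z]
      ring
    · simp [z]
      ring
  obtain ⟨⟨m, rfl⟩, n, rfl⟩ := GaussianInt.exists_rat_eq_of_isIntegral (a := a) (b := b)
    (hC _ (hadd ▸ hz.add hz')) (hC _ (hmul ▸ hz.mul hz'))
  exact ⟨m, n, by simp⟩

/-- The involution of the ring of integers induced by an involution of a field whose fixed field is
generated by a square root of `-1`. -/
noncomputable def GaussianInvolution.ofRingEquiv {K : Type*} [Field K] [CharZero K] (i : K)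
    (hi : i * i = -1) (σ : K ≃+* K) (hσi : σ i = i) (invol : ∀ x, σ (σ x) = x)
    (fixed : ∀ x, σ x = x → ∃ a b : ℚ, x = a + b * i) :
    GaussianInvolution (integralClosure ℤ K) where
  φ := Zsqrtd.lift ⟨⟨i, IsIntegral.of_pow two_pos (by
    rw [pow_two, hi]; exact isIntegral_one.neg)⟩, Subtype.ext (by simp [hi])⟩
  σ := (AlgEquiv.mapIntegralClosure (RingEquiv.toIntAlgEquiv σ)).toRingEquiv
  injective := Zsqrtd.lift_injective _ (fun n h => by nlinarith [mul_self_nonneg n])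
  map_φ z := Subtype.ext (by simp [hσi])
  invol x := Subtype.ext (invol x)
  exists_of_fixed x hx := by
    obtain ⟨a, b, hab⟩ := fixed x (congrArg Subtype.val hx)
    have hint := x.2
    rw [hab] at hint
    obtain ⟨m, n, h⟩ := GaussianInt.exists_eq_of_isIntegral hi hint
    exact ⟨⟨m, n⟩, Subtype.ext (by simp [hab, h])⟩

end BiquadraticField

section Main

theorem GaussianRat.sq_ne_natCast {n : ℕ} (hn : ¬ IsSquare n) (r : GaussianRat) :
    r ^ 2 ≠ n + 0 * r := by
  intro h
  rw [zero_mul, add_zero, pow_two] at h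
  have hre := congrArg QuadraticAlgebra.re h
  have him := congrArg QuadraticAlgebra.im h
  simp at hre him
  have hn0 : (0 : ℚ) ≤ n := Nat.cast_nonneg n
  have him' : r.re * r.im = 0 := by linarith
  rcases mul_eq_zero.1 him' with h0 | h0
  · rw [h0] at hre
    have hn' : (n : ℚ) = 0 := by nlinarith [mul_self_nonneg r.im]
    rw [Nat.cast_eq_zero] at hn'
    exact hn ⟨0, hn'⟩
  · rw [h0] at hre
    refine hn (Rat.isSquare_natCast_iff.1 ⟨r.re, ?_⟩)
    linarith

theorem exists_involution_adjoin_sqrt_I {n : ℕ} (hn : ¬ IsSquare n) {δ : ℂ} (hδ : δ * δ = n)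
    (hδK : δ ∈ IntermediateField.adjoin ℚ {δ, Complex.I})
    (hIK : Complex.I ∈ IntermediateField.adjoin ℚ {δ, Complex.I}) :
    ∃ σ : IntermediateField.adjoin ℚ {δ, Complex.I} ≃+* IntermediateField.adjoin ℚ {δ, Complex.I},
      σ ⟨Complex.I, hIK⟩ = ⟨Complex.I, hIK⟩ ∧ σ ⟨δ, hδK⟩ = -⟨δ, hδK⟩ ∧ (∀ x, σ (σ x) = x) ∧
      ∀ x, σ x = x → ∃ a b : ℚ, x = a + b * ⟨Complex.I, hIK⟩ := by
  have : Fact (∀ r : GaussianRat, r ^ 2 ≠ n + 0 * r) := ⟨GaussianRat.sq_ne_natCast hn⟩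
  let K := IntermediateField.adjoin ℚ {δ, Complex.I}
  let i : K := ⟨Complex.I, hIK⟩
  let t : K := ⟨δ, hδK⟩
  have hi : i * i = -1 := Subtype.ext (by simp [i])
  let f : QuadraticAlgebra GaussianRat n 0 →+* K :=
    QuadraticAlgebra.liftRingHom (GaussianRat.lift i hi) t
      (by rw [map_natCast]; exact Subtype.ext (by simpa [t] using hδ))
  have hf : ∀ z, f z = z.re.re + z.re.im * i + (z.im.re + z.im.im * i) * t := fun z => rfl
  have hsurj : Function.Surjective f := by
    let T : IntermediateField ℚ ℂ :=
      ((algebraMap K ℂ).comp f).fieldRange.toIntermediateField fun r => by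
        refine ⟨⟨⟨r, 0⟩, 0⟩, ?_⟩
        simp [hf]
    have hT : K ≤ T := by
      rw [IntermediateField.adjoin_le_iff]
      rintro x (rfl | rfl)
      · exact ⟨⟨0, ⟨1, 0⟩⟩, by simp [hf, t]⟩
      · exact ⟨⟨⟨0, 1⟩, 0⟩, by simp [hf, i]⟩
    intro x
    obtain ⟨z, hz⟩ := hT x.2
    exact ⟨z, Subtype.ext hz⟩
  let e : QuadraticAlgebra GaussianRat n 0 ≃+* K := RingEquiv.ofBijective f ⟨f.injective, hsurj⟩
  have he : ∀ z, e z = z.re.re + z.re.im * i + (z.im.re + z.im.im * i) * t := hf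
  have hei : e ⟨⟨0, 1⟩, 0⟩ = i := by simp [he]
  have het : e ⟨0, ⟨1, 0⟩⟩ = t := by simp [he]
  refine ⟨(e.symm.trans starRingAut).trans e, ?_, ?_, fun x => ?_, fun x hx => ?_⟩
  · change e (star (e.symm i)) = i
    rw [← hei, e.symm_apply_apply]
    congr 1
    simp
  · change e (star (e.symm t)) = -t
    rw [← het, e.symm_apply_apply, ← map_neg]
    congr 1
    simp
  · change e (star (e.symm (e (star (e.symm x))))) = x
    rw [e.symm_apply_apply, star_star, e.apply_symm_apply]
  · change e (star (e.symm x)) = x at hx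
    obtain ⟨z, rfl⟩ := e.surjective x
    rw [e.symm_apply_apply] at hx
    have him := congrArg QuadraticAlgebra.im (e.injective hx)
    have him' : z.im = 0 := by
      rw [QuadraticAlgebra.im_star, neg_eq_self] at him
      exact him
    exact ⟨z.re.re, z.re.im, by rw [he, him']; simp; exact Or.inl rfl⟩

theorem twoClassGroup_Qsqrt2pq_i_type_two_two
    (p q : ℕ) [Fact (Nat.Prime p)] [Fact (Nat.Prime q)]
    (hp : p % 8 = 5) (hq : q % 8 = 3) :
    TwoClassGroupIsTypeTwoTwo (IntermediateField.adjoin ℚ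
      {((Real.sqrt (2 * p * q) : ℝ) : ℂ), Complex.I}) := by
  have hδ : ((Real.sqrt (2 * p * q) : ℝ) : ℂ) * ((Real.sqrt (2 * p * q) : ℝ) : ℂ) =
      ((2 * p * q : ℕ) : ℂ) := by
    rw [← Complex.ofReal_mul, Real.mul_self_sqrt (by positivity)]
    push_cast
    rfl
  have hn : ¬ IsSquare (2 * p * q) := by
    rintro ⟨r, hr⟩
    have h4 : (2 * p * q) % 4 = 2 := by
      obtain ⟨k, rfl⟩ : ∃ k, p = 2 * k + 1 := ⟨p / 2, by omega⟩
      obtain ⟨l, rfl⟩ : ∃ l, q = 2 * l + 1 := ⟨q / 2, by omega⟩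
      ring_nf
      omega
    rw [hr] at h4
    rcases Nat.even_or_odd' r with ⟨k, rfl | rfl⟩ <;> ring_nf at h4 <;> omega
  generalize ((Real.sqrt (2 * p * q) : ℝ) : ℂ) = δ at hδ
  have hδK : δ ∈ IntermediateField.adjoin ℚ {δ, Complex.I} :=
    IntermediateField.subset_adjoin _ _ (by simp)
  have hIK : Complex.I ∈ IntermediateField.adjoin ℚ {δ, Complex.I} :=
    IntermediateField.subset_adjoin _ _ (by simp)
  obtain ⟨σ, hσI, hσδ, invol, fixed⟩ := exists_involution_adjoin_sqrt_I hn hδ hδK hIK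
  have hδint : IsIntegral ℤ δ := IsIntegral.of_pow two_pos (by
    rw [pow_two, hδ, ← map_natCast (algebraMap ℤ ℂ)]
    exact isIntegral_algebraMap)
  have hIint : IsIntegral ℚ Complex.I := Complex.isIntegral_rat_I
  have : FiniteDimensional ℚ (IntermediateField.adjoin ℚ {δ, Complex.I}) := by
    refine IntermediateField.finiteDimensional_adjoin ?_
    rintro x (rfl | rfl)
    · exact hδint.tower_top
    · exact hIint
  have : NumberField (IntermediateField.adjoin ℚ {δ, Complex.I}) := ⟨⟩
  have : IsDedekindDomain (integralClosure ℤ (IntermediateField.adjoin ℚ {δ, Complex.I})) :=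
    integralClosure.isDedekindDomain ℤ ℚ _
  have : Finite (ClassGroup (integralClosure ℤ (IntermediateField.adjoin ℚ {δ, Complex.I}))) :=
    inferInstanceAs (Finite (ClassGroup
      (NumberField.RingOfIntegers (IntermediateField.adjoin ℚ {δ, Complex.I}))))
  have hδint' : IsIntegral ℤ (⟨δ, hδK⟩ : IntermediateField.adjoin ℚ {δ, Complex.I}) :=
    (isIntegral_algHom_iff (algebraMap (IntermediateField.adjoin ℚ {δ, Complex.I}) ℂ).toIntAlgHom
      (algebraMap (IntermediateField.adjoin ℚ {δ, Complex.I}) ℂ).injective).1 hδint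
  let S := GaussianInvolution.ofRingEquiv ⟨Complex.I, hIK⟩
    (Subtype.ext (by simp)) σ hσI invol fixed
  refine S.nonempty_mulEquiv_zmod_two_prod (δ := ⟨⟨δ, hδK⟩, hδint'⟩) hp hq (Subtype.ext hσδ) ?_
  rw [map_mul, map_mul, map_ofNat, map_natCast, map_natCast]
  refine Subtype.ext (Subtype.ext ?_)
  rw [pow_two]
  push_cast at hδ
  exact hδ

end Main
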